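/- arXiv:math/0312512 — 8 statements merged into one kernel-verified Lean document; each statement's English description precedes it below -/
import Mathlib

section
/- Let V be a finite-dimensional complex vector space and n a positive integer. If σ is a permutation of Fin n which is a single cycle of length n (i.e. σ is a cycle whose support is all of Fin n), then the trace of the ℂ-linear automorphism of the n-fold tensor power ⨂_{i : Fin n} V that permutes the tensor factors according to σ equals dim_ℂ V. -/
open scoped TensorProduct

/-- The trace of the permutation action on a tensor power counts the families of basis indices
that are invariant under the permutation. -/
theorem trace_piTensorProduct_reindex {R M ι κ : Type*} [CommRing R] [AddCommGroup M] [Module R M]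
    [Fintype ι] [Finite κ] (b : Module.Basis κ R M) (σ : Equiv.Perm ι) :
    LinearMap.trace R (⨂[R] _ : ι, M)
        ((PiTensorProduct.reindex R (fun _ : ι => M) σ).toLinearMap)
      = (Nat.card {p : ι → κ // ∀ i, p (σ i) = p i} : R) := by
  classical
  have := Fintype.ofFinite κ
  rw [LinearMap.trace_eq_matrix_trace R (Basis.piTensorProduct fun _ : ι => b), Matrix.trace,
    Nat.card_eq_fintype_card, Fintype.card_subtype, Finset.card_filter, Nat.cast_sum]
  refine Finset.sum_congr rfl fun p _ => ?_
  rw [Matrix.diag_apply, LinearMap.toMatrix_apply, Basis.piTensorProduct_apply,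
    LinearEquiv.coe_coe]
  erw [PiTensorProduct.reindex_tprod]
  rw [Basis.piTensorProduct_repr_tprod_apply]
  simp only [Module.Basis.repr_self, Finsupp.single_apply, Fintype.prod_ite_zero,
    Finset.prod_const_one, Nat.cast_ite, Nat.cast_one, Nat.cast_zero]
  refine if_congr ⟨fun h i => ?_, fun h i => ?_⟩ rfl rfl
  · simpa using (h (σ i)).symm
  · simpa using (h (σ.symm i)).symm

/-- A function invariant under a permutation is constant on its cycles. -/
theorem Equiv.Perm.SameCycle.apply_eq_of_invariant {ι κ : Type*} {σ : Equiv.Perm ι} {x y : ι}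
    (h : σ.SameCycle x y) {p : ι → κ} (hp : ∀ i, p (σ i) = p i) : p x = p y := by
  obtain ⟨k, rfl⟩ := h
  induction k with
  | zero => simp
  | succ k ih => rw [add_comm, zpow_add, zpow_one, Equiv.Perm.mul_apply, hp, ih]
  | pred k ih => rw [ih, ← hp ((σ ^ (-(k : ℤ) - 1)) x), ← Equiv.Perm.mul_apply, ← zpow_one_add,
      add_sub_cancel]

/-- The functions invariant under a transitive permutation are the constant functions. -/
theorem card_invariant_of_sameCycle {ι κ : Type*} [Nonempty ι] (σ : Equiv.Perm ι)
    (hσ : ∀ x y, σ.SameCycle x y) :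
    Nat.card {p : ι → κ // ∀ i, p (σ i) = p i} = Nat.card κ := by
  obtain ⟨i₀⟩ := ‹Nonempty ι›
  exact Nat.card_congr
    { toFun := fun p => p.1 i₀
      invFun := fun c => ⟨fun _ => c, fun _ => rfl⟩
      left_inv := fun p => Subtype.ext <| funext fun i =>
        (hσ i₀ i).apply_eq_of_invariant p.2
      right_inv := fun _ => rfl }

/-- If `σ` is a permutation of `Fin n` which is a single cycle of length `n`
(i.e. a cycle whose support is all of `Fin n`), then the trace of the `ℂ`-linear
automorphism of the `n`-fold tensor power `⨂ (i : Fin n), V` permuting the tensor factors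
according to `σ` (given by `PiTensorProduct.reindex`) equals `dim_ℂ V`. -/
theorem trace_cyclic_permutation_tensor_power
    (V : Type*) [AddCommGroup V] [Module ℂ V] [FiniteDimensional ℂ V]
    (n : ℕ) (hn : 0 < n) (σ : Equiv.Perm (Fin n)) (hcyc : σ.IsCycle)
    (hsupp : σ.support = Finset.univ) :
    LinearMap.trace ℂ _
        ((PiTensorProduct.reindex ℂ (fun _ : Fin n => V) σ).toLinearMap)
      = (Module.finrank ℂ V : ℂ) := by
  have : Nonempty (Fin n) := ⟨⟨0, hn⟩⟩
  have hmoved (x : Fin n) : σ x ≠ x := by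
    rw [← Equiv.Perm.mem_support, hsupp]
    exact Finset.mem_univ x
  rw [Module.finrank_eq_nat_card_basis (Module.finBasis ℂ V),
    ← card_invariant_of_sameCycle σ fun x y => hcyc.sameCycle (hmoved x) (hmoved y)]
  exact trace_piTensorProduct_reindex (Module.finBasis ℂ V) σ
end

section
/- Let G be a finite group, H a complex Hilbert space, m a positive integer, and A : G → Matrix (Fin m) (Fin m) ℂ a matrix representation of G (A(gh) = A(g)·A(h), A(1) = 1, each A(g) invertible). Suppose v_1, …, v_m : H → H are bounded operators with v_i* ∘ v_j = δ_{ij} · id_H, and for each h ∈ G an invertible bounded operator u_h on H is given such that u_h ∘ v_i ∘ u_h⁻¹ = ∑_j (A h)_{j i} · v_j for all i. Let W ⊆ H be a finite-dimensional subspace with u_h W = W for all h ∈ G. Then the ℂ-linear map Φ : (Fin m → ℂ) ⊗[ℂ] W → H determined by Φ(e_i ⊗ w) = v_i w (e_i the standard basis) is injective and intertwines the actions: Φ((A h · x) ⊗ (u_h w)) = u_h (Φ(x ⊗ w)) for all h ∈ G, x ∈ (Fin m → ℂ), w ∈ W. -/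
open scoped TensorProduct

theorem pi_tmul_eq_sum_single_tmul {R ι M : Type*} [CommSemiring R] [Fintype ι] [DecidableEq ι]
    [AddCommMonoid M] [Module R M] (x : ι → R) (w : M) :
    x ⊗ₜ[R] w = ∑ i, (Pi.single i 1 : ι → R) ⊗ₜ[R] (x i • w) := by
  conv_lhs => rw [pi_eq_sum_univ' x]
  simp only [TensorProduct.sum_tmul, TensorProduct.smul_tmul]

theorem exists_eq_sum_single_tmul {R ι M : Type*} [CommSemiring R] [Fintype ι] [DecidableEq ι]
    [AddCommMonoid M] [Module R M] (t : (ι → R) ⊗[R] M) :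
    ∃ f : ι → M, t = ∑ i, (Pi.single i 1 : ι → R) ⊗ₜ[R] f i := by
  induction t with
  | zero => exact ⟨0, by simp⟩
  | tmul x w => exact ⟨fun i => x i • w, pi_tmul_eq_sum_single_tmul x w⟩
  | add s t hs ht =>
    obtain ⟨f, rfl⟩ := hs
    obtain ⟨g, rfl⟩ := ht
    exact ⟨f + g, by simp [TensorProduct.tmul_add, Finset.sum_add_distrib]⟩

/-- Inside a representation of a finite group `G` on a Hilbert space `H`
containing a multiplet of isometries `v i` transforming according to a matrix
representation `A` of `G` (via the invertible operators `u h`), and a finite-dimensional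
`u`-invariant subspace `W`, the linear map `Φ : (Fin m → ℂ) ⊗ W → H` determined by
`Φ (eᵢ ⊗ w) = v i w` is injective and intertwines the actions. -/
theorem tensor_multiplet_injective_intertwines
    {G : Type*} [Group G] [Finite G]
    {H : Type*} [NormedAddCommGroup H] [InnerProductSpace ℂ H] [CompleteSpace H]
    (m : ℕ) (hm : 0 < m)
    (A : G → Matrix (Fin m) (Fin m) ℂ)
    (hAmul : ∀ g h : G, A (g * h) = A g * A h) (hAone : A 1 = 1)
    (hAinv : ∀ g : G, IsUnit (A g))
    (v : Fin m → (H →L[ℂ] H))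
    (hv : ∀ i j, (ContinuousLinearMap.adjoint (v i)).comp (v j)
      = if i = j then (1 : H →L[ℂ] H) else 0)
    (u : G → (H ≃L[ℂ] H))
    (hu : ∀ (h : G) (i : Fin m),
      ((u h : H →L[ℂ] H).comp (v i)).comp ((u h).symm : H →L[ℂ] H)
        = ∑ j, A h j i • v j)
    (W : Submodule ℂ H) [FiniteDimensional ℂ W]
    (hW : ∀ h : G, (u h) '' (W : Set H) = (W : Set H))
    (Φ : ((Fin m → ℂ) ⊗[ℂ] W) →ₗ[ℂ] H)
    (hΦ : ∀ (i : Fin m) (w : W), Φ ((Pi.single i 1 : Fin m → ℂ) ⊗ₜ[ℂ] w) = v i (w : H)) :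
    Function.Injective Φ ∧
      ∀ (h : G) (x : Fin m → ℂ) (w : H) (hw : w ∈ W) (hw' : u h w ∈ W),
        Φ ((A h).mulVec x ⊗ₜ[ℂ] (⟨u h w, hw'⟩ : W)) = u h (Φ (x ⊗ₜ[ℂ] (⟨w, hw⟩ : W))) := by
  have hΦ_tmul (x : Fin m → ℂ) (w : W) : Φ (x ⊗ₜ[ℂ] w) = ∑ i, x i • v i (w : H) := by
    rw [pi_tmul_eq_sum_single_tmul, map_sum]
    simp [hΦ]
  refine ⟨?_, fun h x w hw hw' => ?_⟩
  · rw [injective_iff_map_eq_zero]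
    intro t ht
    obtain ⟨f, rfl⟩ := exists_eq_sum_single_tmul t
    have hadj (i j : Fin m) (y : H) :
        ContinuousLinearMap.adjoint (v i) (v j y) = if i = j then y else 0 := by
      have := DFunLike.congr_fun (hv i j) y
      split_ifs at this ⊢ <;> simpa using this
    have hf (j : Fin m) : f j = 0 := by
      have := congrArg (ContinuousLinearMap.adjoint (v j)) ht
      simpa [hΦ, hadj] using this
    simp [hf]
  · have huv (i : Fin m) : u h (v i w) = ∑ j, A h j i • v j (u h w) := by
      simpa [sum_apply] using DFunLike.congr_fun (hu h i) (u h w)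
    simp only [hΦ_tmul, map_sum, map_smul, huv, Matrix.mulVec, dotProduct, Finset.sum_smul,
      Finset.smul_sum, smul_smul]
    rw [Finset.sum_comm]
    simp only [mul_comm]
end

section
/- Let S be a modular S-matrix on a finite type L with distinguished element 1. If χ : L → ℂ is not identically zero and satisfies χ(λ) · χ(μ) = ∑_{ν ∈ L} N λ μ ν · χ(ν) for all λ, μ ∈ L, then there exists μ₀ ∈ L such that χ(λ) = S λ μ₀ / S 1 μ₀ for all λ ∈ L. -/
open scoped BigOperators

/-- Verlinde fusion numbers associated to a matrix `S` and the vacuum label `one`. -/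
noncomputable def verlindeN {L : Type*} [Fintype L] [DecidableEq L] (S : Matrix L L ℂ) (one : L)
    (l m n : L) : ℂ :=
  ∑ δ, S l δ * S m δ * (starRingEnd ℂ) (S n δ) / S one δ

/-- `S` is a modular S-matrix: unitary, symmetric, with strictly positive first row,
and all Verlinde numbers nonnegative integers. -/
def IsModularS {L : Type*} [Fintype L] [DecidableEq L] (one : L) (S : Matrix L L ℂ) : Prop :=
  S * S.conjTranspose = 1 ∧
  (∀ l m, S l m = S m l) ∧
  (∀ l, ∃ r : ℝ, 0 < r ∧ S one l = (r : ℂ)) ∧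
  (∀ l m n, ∃ k : ℕ, verlindeN S one l m n = (k : ℂ))

/-- The Verlinde numbers act on a function through its pairings with the columns of `S`. -/
theorem sum_verlindeN_mul {L : Type*} [Fintype L] [DecidableEq L] (S : Matrix L L ℂ) (one : L)
    (χ : L → ℂ) (l m : L) :
    ∑ n, verlindeN S one l m n * χ n =
      ∑ δ, S l δ / S one δ * (∑ n, starRingEnd ℂ (S n δ) * χ n) * S m δ := by
  simp only [verlindeN, Finset.sum_mul, Finset.mul_sum]
  rw [Finset.sum_comm]
  refine Finset.sum_congr rfl fun δ _ => Finset.sum_congr rfl fun n _ => ?_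
  ring

/-- The columns of a unitary matrix are orthonormal. -/
theorem sum_conj_mul_of_mul_conjTranspose_eq_one {L : Type*} [Fintype L] [DecidableEq L]
    {S : Matrix L L ℂ} (hS : S * S.conjTranspose = 1) (ε δ : L) :
    ∑ m, starRingEnd ℂ (S m ε) * S m δ = if ε = δ then 1 else 0 := by
  have h : (S.conjTranspose * S) ε δ = (1 : Matrix L L ℂ) ε δ := by rw [mul_eq_one_comm.mp hS]
  simpa [Matrix.mul_apply, Matrix.one_apply] using h

/-- every nonzero character of the fusion algebra of a modular S-matrix is of
the form `λ ↦ S λ μ₀ / S 1 μ₀` for some `μ₀`. -/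
theorem fusion_character_eq_S_column
    {L : Type*} [Fintype L] [DecidableEq L] (one : L) (S : Matrix L L ℂ) (hS : IsModularS one S)
    (χ : L → ℂ) (hχ : χ ≠ 0)
    (hmul : ∀ l m, χ l * χ m = ∑ n, verlindeN S one l m n * χ n) :
    ∃ μ₀ : L, ∀ l, χ l = S l μ₀ / S one μ₀ := by
  set c : L → ℂ := fun δ => ∑ n, starRingEnd ℂ (S n δ) * χ n with hc
  have hexp : ∀ l m, χ l * χ m = ∑ δ, S l δ / S one δ * c δ * S m δ := fun l m =>
    (hmul l m).trans (sum_verlindeN_mul S one χ l m)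
  obtain ⟨ε, hε⟩ : ∃ ε, c ε ≠ 0 := by
    by_contra! h
    refine hχ (funext fun l => ?_)
    simpa [h] using hexp l l
  refine ⟨ε, fun l => mul_right_cancel₀ hε ?_⟩
  calc χ l * c ε = ∑ m, starRingEnd ℂ (S m ε) * (χ l * χ m) := by
        rw [hc, Finset.mul_sum]
        exact Finset.sum_congr rfl fun m _ => by ring
    _ = ∑ δ, S l δ / S one δ * c δ * ∑ m, starRingEnd ℂ (S m ε) * S m δ := by
        simp only [hexp, Finset.mul_sum]
        rw [Finset.sum_comm]
        refine Finset.sum_congr rfl fun δ _ => Finset.sum_congr rfl fun m _ => ?_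
        ring
    _ = S l ε / S one ε * c ε := by
        simp [sum_conj_mul_of_mul_conjTranspose_eq_one hS.1]
end

section
/- Let L be a finite type with a distinguished element 1, let s : L → ℝ satisfy s(λ) > 0 for all λ, let Δ : L → ℝ, and let c, c₀, ċ₀ ∈ ℝ. Assume the Gauss-sum relation ∑_{λ ∈ L} s(λ)² e^{2πi Δ(λ)} = e^{2πi c₀/8} · s(1), and assume the ℤ₂-orbifold Gauss-sum relation (1/2) ∑_{(λ,μ) : λ ≠ μ} s(λ)² s(μ)² e^{2πi(Δ(λ)+Δ(μ))} + (1/2) ∑_{λ ∈ L} s(λ)⁴ e^{4πi Δ(λ)} + (1/4) ∑_{λ ∈ L} ∑_{ε ∈ {0,1}} s(λ)² e^{πi(Δ(λ) + ε + c/8)} = e^{2πi ċ₀/8} · (1/2) s(1)². Then ċ₀ − 2c₀ ∈ 8ℤ. -/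
open scoped BigOperators
open Complex

/-- A double sum splits into its off-diagonal and diagonal parts. -/
lemma sum_offDiag_add_sum_diag_eq_sq {L R : Type*} [Fintype L] [DecidableEq L] [CommSemiring R]
    (a : L → R) :
    ∑ p ∈ Finset.univ.filter (fun p : L × L => p.1 ≠ p.2), a p.1 * a p.2 + ∑ l, a l ^ 2
      = (∑ l, a l) ^ 2 := by
  have hdiag : ∑ l, a l ^ 2 =
      ∑ p ∈ Finset.univ.filter (fun p : L × L => p.1 = p.2), a p.1 * a p.2 := by
    simp [Finset.sum_filter, Fintype.sum_prod_type, sq]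
  rw [hdiag, add_comm, Finset.sum_filter_add_sum_filter_not, sq, Finset.sum_mul_sum,
    Fintype.sum_prod_type]

/-- The two phases of a twisted sector differ by a sign. -/
lemma sum_exp_pi_mul_I_fin_two (x y : ℂ) :
    ∑ ε : Fin 2, Complex.exp ((Real.pi : ℂ) * Complex.I * (x + ((ε : ℕ) : ℂ) + y)) = 0 := by
  have h : (Real.pi : ℂ) * Complex.I * (x + 1 + y)
      = (Real.pi : ℂ) * Complex.I * (x + y) + Real.pi * Complex.I := by ring
  simp [Fin.sum_univ_two, h, Complex.exp_add]

/-- if the Gauss sum of the chiral data satisfies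
`∑ s(λ)² e^{2πiΔ(λ)} = e^{2πic₀/8} s(1)` and the ℤ₂-orbifold Gauss sum satisfies the
corresponding relation with phase `dotc₀`, then `dotc₀ − 2c₀ ∈ 8ℤ`. -/
theorem orbifold_central_charge_mod_eight
    {L : Type*} [Fintype L] [DecidableEq L] (one : L)
    (s : L → ℝ) (hs : ∀ l, 0 < s l) (Δ : L → ℝ) (c c₀ dotc₀ : ℝ)
    (h1 : ∑ l, (s l : ℂ) ^ 2 * Complex.exp (2 * (Real.pi : ℂ) * Complex.I * (Δ l : ℂ))
        = Complex.exp (2 * (Real.pi : ℂ) * Complex.I * (c₀ : ℂ) / 8) * (s one : ℂ))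
    (h2 : (1 / 2 : ℂ) * ∑ p ∈ Finset.univ.filter (fun p : L × L => p.1 ≠ p.2),
            (s p.1 : ℂ) ^ 2 * (s p.2 : ℂ) ^ 2 *
              Complex.exp (2 * (Real.pi : ℂ) * Complex.I * ((Δ p.1 : ℂ) + (Δ p.2 : ℂ)))
        + (1 / 2 : ℂ) * ∑ l, (s l : ℂ) ^ 4 *
              Complex.exp (4 * (Real.pi : ℂ) * Complex.I * (Δ l : ℂ))
        + (1 / 4 : ℂ) * ∑ l, ∑ ε : Fin 2, (s l : ℂ) ^ 2 *
              Complex.exp ((Real.pi : ℂ) * Complex.I *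
                ((Δ l : ℂ) + ((ε : ℕ) : ℂ) + (c : ℂ) / 8))
        = Complex.exp (2 * (Real.pi : ℂ) * Complex.I * (dotc₀ : ℂ) / 8) *
            ((1 / 2 : ℂ) * (s one : ℂ) ^ 2)) :
    ∃ k : ℤ, dotc₀ - 2 * c₀ = 8 * k := by
  have htwisted : ∑ l, ∑ ε : Fin 2, (s l : ℂ) ^ 2 * Complex.exp ((Real.pi : ℂ) * Complex.I *
      ((Δ l : ℂ) + ((ε : ℕ) : ℂ) + (c : ℂ) / 8)) = 0 := by
    simp_rw [← Finset.mul_sum, sum_exp_pi_mul_I_fin_two, mul_zero, Finset.sum_const_zero]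
  have hsq := sum_offDiag_add_sum_diag_eq_sq fun l =>
    (s l : ℂ) ^ 2 * Complex.exp (2 * (Real.pi : ℂ) * Complex.I * (Δ l : ℂ))
  have hoff : ∀ p : L × L,
      ((s p.1 : ℂ) ^ 2 * Complex.exp (2 * (Real.pi : ℂ) * Complex.I * (Δ p.1 : ℂ))) *
        ((s p.2 : ℂ) ^ 2 * Complex.exp (2 * (Real.pi : ℂ) * Complex.I * (Δ p.2 : ℂ)))
      = (s p.1 : ℂ) ^ 2 * (s p.2 : ℂ) ^ 2 *
        Complex.exp (2 * (Real.pi : ℂ) * Complex.I * ((Δ p.1 : ℂ) + (Δ p.2 : ℂ))) := by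
    intro p
    rw [mul_add, Complex.exp_add]
    ring
  have hdiag : ∀ l,
      ((s l : ℂ) ^ 2 * Complex.exp (2 * (Real.pi : ℂ) * Complex.I * (Δ l : ℂ))) ^ 2
      = (s l : ℂ) ^ 4 * Complex.exp (4 * (Real.pi : ℂ) * Complex.I * (Δ l : ℂ)) := by
    intro l
    rw [mul_pow, ← pow_mul, ← Complex.exp_nat_mul]
    congr 2
    push_cast
    ring
  simp only [hoff, hdiag] at hsq
  rw [htwisted, mul_zero, add_zero, ← mul_add, hsq, h1, mul_pow, ← Complex.exp_nat_mul] at h2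
  have hone : (1 / 2 : ℂ) * (s one : ℂ) ^ 2 ≠ 0 := by
    simp [(hs one).ne']
  have hexp := mul_right_cancel₀ hone (h2.symm.trans (mul_left_comm _ _ _))
  obtain ⟨n, hn⟩ := Complex.exp_eq_exp_iff_exists_int.mp hexp
  refine ⟨n, ?_⟩
  have hz : 2 * (Real.pi : ℂ) * Complex.I ≠ 0 := Complex.two_pi_I_ne_zero
  have key : ((dotc₀ : ℂ) - 2 * c₀) = 8 * n := by
    apply mul_left_cancel₀ hz
    push_cast at hn
    linear_combination 8 * hn
  exact_mod_cast key
end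

section
/- With the ℤ₂-orbifold Verlinde numbers Ṅ defined from any symmetric matrix S (with nonvanishing first row) and any auxiliary matrix P as in the context: for all λ, λ₁, λ₂ ∈ L and ε, ε₁, ε₂ ∈ {0,1}, Ṅ (λ,ε) (λ₁,ε₁) (λ₂,ε₂) = (1/2) · N λ λ₁ λ₂ · (N λ λ₁ λ₂ + (−1)^{ε+ε₁+ε₂}). -/
open scoped BigOperators

/-- Labels of the ℤ₂ permutation orbifold: (representatives of) unordered pairs `{λ, μ}`,
diagonal labels `(λ, ε)`, and twisted labels `(λ, ε)^`. -/
inductive OrbL (L : Type*) where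
  | pair : L → L → OrbL L
  | diag : L → Fin 2 → OrbL L
  | tw : L → Fin 2 → OrbL L

/-- The symmetric ℤ₂-orbifold S-matrix built from `S` and the auxiliary matrix `P`.
On pair labels it is independent of the order of the two components. -/
noncomputable def dotS {L : Type*} (S P : Matrix L L ℂ) : OrbL L → OrbL L → ℂ
  | .pair l m, .pair l' m' => S l l' * S m m' + S l m' * S m l'
  | .pair l m, .diag l' _ => S l l' * S m l'
  | .pair _ _, .tw _ _ => 0
  | .diag l' _, .pair l m => S l l' * S m l'
  | .diag l _, .diag l' _ => (1 / 2 : ℂ) * (S l l') ^ 2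
  | .diag l e, .tw l' _ => (1 / 2 : ℂ) * (-1) ^ (e : ℕ) * S l l'
  | .tw _ _, .pair _ _ => 0
  | .tw l' _, .diag l e => (1 / 2 : ℂ) * (-1) ^ (e : ℕ) * S l l'
  | .tw l e, .tw l' e' => (1 / 2 : ℂ) * (-1) ^ ((e : ℕ) + (e' : ℕ)) * P l l'

/-- The Verlinde fusion numbers of `S` with vacuum `one`. -/
noncomputable def fusN {L : Type*} [Fintype L] (S : Matrix L L ℂ) (one : L)
    (l m n : L) : ℂ :=
  ∑ δ, S l δ * S m δ * (starRingEnd ℂ) (S n δ) / S one δ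

/-- The ℤ₂-orbifold Verlinde numbers `Ṅ a b c = ∑_{x} Ṡ a x · Ṡ b x · conj (Ṡ c x) / Ṡ vac x`,
where `x` runs over all orbifold labels: the sum over unordered pairs `{λ', μ'}` (`λ' ≠ μ'`)
is written as half the sum over ordered distinct pairs (the summand being symmetric),
followed by the sums over diagonal and twisted labels; the vacuum is `(1, 0)`. -/
noncomputable def dotN {L : Type*} [Fintype L] [DecidableEq L]
    (S P : Matrix L L ℂ) (one : L) (a b c : OrbL L) : ℂ :=
  (1 / 2 : ℂ) * ∑ p ∈ Finset.univ.filter (fun p : L × L => p.1 ≠ p.2),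
      dotS S P a (.pair p.1 p.2) * dotS S P b (.pair p.1 p.2) *
        (starRingEnd ℂ) (dotS S P c (.pair p.1 p.2)) /
          dotS S P (.diag one 0) (.pair p.1 p.2)
  + ∑ l, ∑ e : Fin 2,
      dotS S P a (.diag l e) * dotS S P b (.diag l e) *
        (starRingEnd ℂ) (dotS S P c (.diag l e)) / dotS S P (.diag one 0) (.diag l e)
  + ∑ l, ∑ e : Fin 2,
      dotS S P a (.tw l e) * dotS S P b (.tw l e) *
        (starRingEnd ℂ) (dotS S P c (.tw l e)) / dotS S P (.diag one 0) (.tw l e)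

/-- The square of a finite sum splits into its off-diagonal and diagonal parts. -/
theorem sum_offDiag_add_sum_sq {ι R : Type*} [Fintype ι] [DecidableEq ι] [CommSemiring R]
    (f : ι → R) :
    ∑ p ∈ Finset.univ.filter (fun p : ι × ι => p.1 ≠ p.2), f p.1 * f p.2 + ∑ i, f i ^ 2
      = (∑ i, f i) ^ 2 := by
  rw [sq (∑ i, f i), Fintype.sum_mul_sum, ← Fintype.sum_prod_type' (fun i j => f i * f j),
    ← Finset.sum_filter_not_add_sum_filter Finset.univ (fun p : ι × ι => p.1 = p.2)]
  congr 1
  rw [Finset.sum_filter, Fintype.sum_prod_type]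
  simp [sq]

/-- the ℤ₂-orbifold fusion rule for three diagonal labels:
`Ṅ (λ,ε) (λ₁,ε₁) (λ₂,ε₂) = ½ N(λ,λ₁,λ₂) (N(λ,λ₁,λ₂) + (−1)^{ε+ε₁+ε₂})`. -/
theorem orbifold_fusion_diag_diag_diag
    {L : Type*} [Fintype L] [DecidableEq L] (one : L) (S P : Matrix L L ℂ)
    (hsymm : ∀ l m, S l m = S m l) (hne : ∀ δ, S one δ ≠ 0)
    (l l₁ l₂ : L) (e e₁ e₂ : Fin 2) :
    dotN S P one (.diag l e) (.diag l₁ e₁) (.diag l₂ e₂)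
      = (1 / 2 : ℂ) * fusN S one l l₁ l₂ *
          (fusN S one l l₁ l₂ + (-1) ^ ((e : ℕ) + (e₁ : ℕ) + (e₂ : ℕ))) := by
  set f : L → ℂ := fun δ => S l δ * S l₁ δ * (starRingEnd ℂ) (S l₂ δ) / S one δ with hf
  have hN : fusN S one l l₁ l₂ = ∑ δ, f δ := rfl
  have hpair : ∀ p : L × L,
      dotS S P (.diag l e) (.pair p.1 p.2) * dotS S P (.diag l₁ e₁) (.pair p.1 p.2) *
        (starRingEnd ℂ) (dotS S P (.diag l₂ e₂) (.pair p.1 p.2)) /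
          dotS S P (.diag one 0) (.pair p.1 p.2) = f p.1 * f p.2 := by
    intro p
    have h₁ := hne p.1
    have h₂ := hne p.2
    simp only [dotS, hf, hsymm p.1, hsymm p.2, map_mul]
    field_simp
  have hdiag : ∀ δ : L, ∑ x : Fin 2,
      dotS S P (.diag l e) (.diag δ x) * dotS S P (.diag l₁ e₁) (.diag δ x) *
        (starRingEnd ℂ) (dotS S P (.diag l₂ e₂) (.diag δ x)) /
          dotS S P (.diag one 0) (.diag δ x) = (1 / 2 : ℂ) * f δ ^ 2 := by
    intro δ
    have h := hne δ
    simp only [dotS, hf, Fin.sum_univ_two, map_mul, map_pow, map_div₀, map_one, map_ofNat]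
    field_simp
    ring
  have htw : ∀ δ : L, ∑ x : Fin 2,
      dotS S P (.diag l e) (.tw δ x) * dotS S P (.diag l₁ e₁) (.tw δ x) *
        (starRingEnd ℂ) (dotS S P (.diag l₂ e₂) (.tw δ x)) /
          dotS S P (.diag one 0) (.tw δ x)
        = (1 / 2 : ℂ) * (-1) ^ ((e : ℕ) + (e₁ : ℕ) + (e₂ : ℕ)) * f δ := by
    intro δ
    have h := hne δ
    simp only [dotS, hf, Fin.sum_univ_two, map_mul, map_pow, map_neg, map_div₀, map_one,
      map_ofNat, Fin.val_zero, pow_zero, pow_add]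
    field_simp
    ring
  simp only [dotN, hpair, hdiag, htw, hN, ← Finset.mul_sum]
  linear_combination (1 / 2 : ℂ) * sum_offDiag_add_sum_sq f
end

section
/- With the ℤ₂-orbifold Verlinde numbers Ṅ defined from any symmetric matrix S (with nonvanishing first row) and any auxiliary matrix P as in the context: for all λ, μ, λ₁, μ₁, λ₂ ∈ L with λ ≠ μ and λ₁ ≠ μ₁, and all ε ∈ {0,1}, Ṅ {λ,μ} {λ₁,μ₁} (λ₂,ε) = N λ λ₁ λ₂ · N μ μ₁ λ₂ + N λ μ₁ λ₂ · N μ λ₁ λ₂. -/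
open scoped BigOperators

/-- A double sum splits into its off-diagonal and diagonal parts. -/
theorem sum_offDiag_add_sum_diag {L M : Type*} [Fintype L] [DecidableEq L] [AddCommMonoid M]
    (F : L → L → M) :
    ∑ p ∈ Finset.univ.filter (fun p : L × L => p.1 ≠ p.2), F p.1 p.2 + ∑ x, F x x
      = ∑ x, ∑ y, F x y := by
  have h : ∑ p ∈ Finset.univ.filter (fun p : L × L => p.1 = p.2), F p.1 p.2 = ∑ x, F x x := by
    rw [Finset.sum_filter, Fintype.sum_prod_type]
    simp
  rw [← h, ← Fintype.sum_prod_type', add_comm]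
  exact Finset.sum_filter_add_sum_filter_not _ _ _

/-- the ℤ₂-orbifold fusion rule of two untwisted pair sectors into a
diagonal sector: `Ṅ {λ,μ} {λ₁,μ₁} (λ₂,ε) = N(λ,λ₁,λ₂) N(μ,μ₁,λ₂) + N(λ,μ₁,λ₂) N(μ,λ₁,λ₂)`. -/
theorem orbifold_fusion_pair_pair_diag
    {L : Type*} [Fintype L] [DecidableEq L] (one : L) (S P : Matrix L L ℂ)
    (hsymm : ∀ l m, S l m = S m l) (hne : ∀ δ, S one δ ≠ 0)
    (l m l₁ m₁ l₂ : L) (hlm : l ≠ m) (hlm₁ : l₁ ≠ m₁) (e : Fin 2) :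
    dotN S P one (.pair l m) (.pair l₁ m₁) (.diag l₂ e)
      = fusN S one l l₁ l₂ * fusN S one m m₁ l₂
        + fusN S one l m₁ l₂ * fusN S one m l₁ l₂ := by
  let A : L → L → L → ℂ := fun a b x => S a x * S b x * (starRingEnd ℂ) (S l₂ x) / S one x
  let F : L → L → ℂ := fun x y =>
    A l l₁ x * A m m₁ y + A l m₁ x * A m l₁ y + (A l l₁ y * A m m₁ x + A l m₁ y * A m l₁ x)
  have hpair : ∀ x y, dotS S P (.pair l m) (.pair x y) * dotS S P (.pair l₁ m₁) (.pair x y) *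
      (starRingEnd ℂ) (dotS S P (.diag l₂ e) (.pair x y)) /
        dotS S P (.diag one 0) (.pair x y) = F x y := by
    intro x y
    simp only [dotS, F, A, map_mul, hsymm x l₂, hsymm y l₂, hsymm x one, hsymm y one]
    have hx := hne x
    have hy := hne y
    field_simp
    ring
  have hdiag : ∀ x, ∑ f : Fin 2,
      dotS S P (.pair l m) (.diag x f) * dotS S P (.pair l₁ m₁) (.diag x f) *
        (starRingEnd ℂ) (dotS S P (.diag l₂ e) (.diag x f)) /
          dotS S P (.diag one 0) (.diag x f) = (1 / 2 : ℂ) * F x x := by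
    intro x
    have hx := hne x
    simp only [dotS, F, A, Fin.sum_univ_two, map_mul, map_pow, map_div₀, map_one, map_ofNat]
    field_simp
    ring
  have htw : ∀ x, ∑ f : Fin 2,
      dotS S P (.pair l m) (.tw x f) * dotS S P (.pair l₁ m₁) (.tw x f) *
        (starRingEnd ℂ) (dotS S P (.diag l₂ e) (.tw x f)) /
          dotS S P (.diag one 0) (.tw x f) = 0 := by
    simp [dotS]
  have hF : ∑ x, ∑ y, F x y = 2 * (fusN S one l l₁ l₂ * fusN S one m m₁ l₂
      + fusN S one l m₁ l₂ * fusN S one m l₁ l₂) := by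
    have hswap : ∑ x, ∑ y, (A l l₁ y * A m m₁ x + A l m₁ y * A m l₁ x)
        = ∑ x, ∑ y, (A l l₁ x * A m m₁ y + A l m₁ x * A m l₁ y) := Finset.sum_comm
    have hprod : ∑ x, ∑ y, (A l l₁ x * A m m₁ y + A l m₁ x * A m l₁ y)
        = fusN S one l l₁ l₂ * fusN S one m m₁ l₂
          + fusN S one l m₁ l₂ * fusN S one m l₁ l₂ := by
      simp only [fusN, Finset.sum_mul_sum, Finset.sum_add_distrib, A]
    simp only [F]
    simp_rw [Finset.sum_add_distrib (f := fun y => A l l₁ _ * A m m₁ y + A l m₁ _ * A m l₁ y)]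
    rw [Finset.sum_add_distrib, hswap, hprod, two_mul]
  simp only [dotN, hpair, hdiag, htw]
  rw [← Finset.mul_sum, ← mul_add, sum_offDiag_add_sum_diag, hF]
  simp
end

section
/- Assume in addition that S is unitary (∑_{ν ∈ L} S ν α · conj(S ν β) = δ_{αβ} for all α, β) and that there is an involution λ ↦ λ̄ of L with S λ̄ μ = conj(S λ μ) for all λ, μ. Then, with the ℤ₂-orbifold Verlinde numbers Ṅ as in the context (arbitrary auxiliary matrix P): for all λ, λ₁ ∈ L, all ε, ε₁ ∈ {0,1}, and all λ₂, μ₂ ∈ L with λ₂ ≠ μ₂, Ṅ (λ,ε)^ (λ₁,ε₁)^ {λ₂,μ₂} = ∑_{μ ∈ L} N λ λ₁ μ · N μ λ̄₂ μ₂. -/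
open scoped BigOperators

/-- For `S` with orthonormal columns, composing two Verlinde fusions over the intermediate label
gives the four-point Verlinde formula. -/
theorem sum_fusN_mul_fusN {L : Type*} [Fintype L] [DecidableEq L] (one : L) (S : Matrix L L ℂ)
    (hunitary : ∀ α β, (∑ ν, S ν α * (starRingEnd ℂ) (S ν β)) = if α = β then 1 else 0)
    (a b c d : L) :
    ∑ μ, fusN S one a b μ * fusN S one μ c d
      = ∑ δ, S a δ * S b δ * S c δ * (starRingEnd ℂ) (S d δ) / S one δ ^ 2 := by
  simp only [fusN, Finset.sum_mul_sum]
  rw [Finset.sum_comm]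
  refine Finset.sum_congr rfl fun δ _ => ?_
  rw [Finset.sum_comm]
  calc
    _ = ∑ γ, (S a δ * S b δ / S one δ) * (S c γ * (starRingEnd ℂ) (S d γ) / S one γ) *
          ∑ μ, S μ γ * (starRingEnd ℂ) (S μ δ) := by
        refine Finset.sum_congr rfl fun γ _ => ?_
        rw [Finset.mul_sum]
        exact Finset.sum_congr rfl fun μ _ => by ring
    _ = _ := by
        simp only [hunitary, mul_ite, mul_one, mul_zero, Finset.sum_ite_eq', Finset.mem_univ,
          if_true]
        ring

/-- Only the diagonal labels contribute to the fusion of two twisted labels into a pair. -/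
theorem dotN_tw_tw_pair {L : Type*} [Fintype L] [DecidableEq L] (one : L) (S P : Matrix L L ℂ)
    (hne : ∀ δ, S one δ ≠ 0) (l l₁ : L) (e e₁ : Fin 2) (l₂ m₂ : L) :
    dotN S P one (.tw l e) (.tw l₁ e₁) (.pair l₂ m₂)
      = ∑ δ, S δ l * S δ l₁ * (starRingEnd ℂ) (S l₂ δ) * (starRingEnd ℂ) (S m₂ δ)
          / S one δ ^ 2 := by
  simp only [dotN, dotS, zero_mul, zero_div, Finset.sum_const_zero, mul_zero, map_zero, zero_add,
    add_zero, map_mul]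
  refine Finset.sum_congr rfl fun δ _ => ?_
  have h := hne δ
  simp only [Fin.sum_univ_two, Fin.val_zero, Fin.val_one, pow_zero, pow_one]
  field_simp
  ring

/-- assuming in addition that `S` is unitary and admits a conjugation
`λ ↦ λ̄` with `S λ̄ μ = conj (S λ μ)`, the fusion of two twisted sectors into an untwisted
pair sector is `Ṅ (λ,ε)^ (λ₁,ε₁)^ {λ₂,μ₂} = ∑_μ N(λ,λ₁,μ) N(μ,λ̄₂,μ₂)`. -/
theorem orbifold_fusion_tw_tw_pair
    {L : Type*} [Fintype L] [DecidableEq L] (one : L) (S P : Matrix L L ℂ)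
    (hsymm : ∀ l m, S l m = S m l) (hne : ∀ δ, S one δ ≠ 0)
    (hunitary : ∀ α β, (∑ ν, S ν α * (starRingEnd ℂ) (S ν β))
      = if α = β then 1 else 0)
    (bar : L → L) (hbar : ∀ l, bar (bar l) = l)
    (hbarS : ∀ l m, S (bar l) m = (starRingEnd ℂ) (S l m))
    (l l₁ : L) (e e₁ : Fin 2) (l₂ m₂ : L) (hlm₂ : l₂ ≠ m₂) :
    dotN S P one (.tw l e) (.tw l₁ e₁) (.pair l₂ m₂)
      = ∑ μ, fusN S one l l₁ μ * fusN S one μ (bar l₂) m₂ := by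
  rw [dotN_tw_tw_pair one S P hne, sum_fusN_mul_fusN one S hunitary]
  exact Finset.sum_congr rfl fun δ _ => by rw [hbarS, hsymm δ l, hsymm δ l₁]
end

section
/- With the ℤ₂-orbifold Verlinde numbers Ṅ defined from any symmetric matrix S (with nonvanishing first row) and any auxiliary matrix P as in the context: for all λ, μ, λ₁, μ₁, λ₂, μ₂ ∈ L with λ ≠ μ, λ₁ ≠ μ₁, λ₂ ≠ μ₂, Ṅ {λ,μ} {λ₁,μ₁} {λ₂,μ₂} = N λ λ₁ λ₂ · N μ μ₁ μ₂ + N λ λ₁ μ₂ · N μ μ₁ λ₂ + N λ μ₁ λ₂ · N μ λ₁ μ₂ + N λ μ₁ μ₂ · N μ λ₁ λ₂. -/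
open scoped BigOperators

/-- Half the off-diagonal sum of a symmetrized function plus its diagonal sum is the full sum. -/
theorem half_sum_symmetrized_offDiag_add_diag {L : Type*} [Fintype L] [DecidableEq L]
    (G : L → L → ℂ) :
    (1 / 2 : ℂ) * ∑ p ∈ Finset.univ.filter (fun p : L × L => p.1 ≠ p.2),
        (G p.1 p.2 + G p.2 p.1) + ∑ x, G x x = ∑ x, ∑ y, G x y := by
  have hsplit := Finset.sum_filter_add_sum_filter_not (Finset.univ : Finset (L × L))
    (fun p => p.1 ≠ p.2) (fun p => G p.1 p.2 + G p.2 p.1)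
  have hdiag : ∑ p ∈ Finset.univ.filter (fun p : L × L => ¬ p.1 ≠ p.2),
      (G p.1 p.2 + G p.2 p.1) = 2 * ∑ x, G x x := by
    rw [Finset.sum_filter, Fintype.sum_prod_type, Finset.mul_sum]
    refine Finset.sum_congr rfl fun x _ => ?_
    simp [two_mul]
  have hfull : ∑ p : L × L, (G p.1 p.2 + G p.2 p.1) = 2 * ∑ x, ∑ y, G x y := by
    rw [Finset.sum_add_distrib, Fintype.sum_prod_type, Fintype.sum_prod_type_right, two_mul]
  rw [hdiag, hfull] at hsplit
  linear_combination (1 / 2 : ℂ) * hsplit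

/-- the ℤ₂-orbifold fusion rule of three untwisted pair sectors:
`Ṅ {λ,μ} {λ₁,μ₁} {λ₂,μ₂} = N(λ,λ₁,λ₂)N(μ,μ₁,μ₂) + N(λ,λ₁,μ₂)N(μ,μ₁,λ₂)
  + N(λ,μ₁,λ₂)N(μ,λ₁,μ₂) + N(λ,μ₁,μ₂)N(μ,λ₁,λ₂)`. -/
theorem orbifold_fusion_pair_pair_pair
    {L : Type*} [Fintype L] [DecidableEq L] (one : L) (S P : Matrix L L ℂ)
    (hsymm : ∀ l m, S l m = S m l) (hne : ∀ δ, S one δ ≠ 0)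
    (l m l₁ m₁ l₂ m₂ : L) (hlm : l ≠ m) (hlm₁ : l₁ ≠ m₁) (hlm₂ : l₂ ≠ m₂) :
    dotN S P one (.pair l m) (.pair l₁ m₁) (.pair l₂ m₂)
      = fusN S one l l₁ l₂ * fusN S one m m₁ m₂
        + fusN S one l l₁ m₂ * fusN S one m m₁ l₂
        + fusN S one l m₁ l₂ * fusN S one m l₁ m₂
        + fusN S one l m₁ m₂ * fusN S one m l₁ l₂ := by
  have hpair : ∀ x y, dotS S P (.pair l m) (.pair x y) * dotS S P (.pair l₁ m₁) (.pair x y) *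
        (starRingEnd ℂ) (dotS S P (.pair l₂ m₂) (.pair x y)) /
          dotS S P (.diag one 0) (.pair x y)
      = S l x * S m y * dotS S P (.pair l₁ m₁) (.pair x y) *
          (starRingEnd ℂ) (dotS S P (.pair l₂ m₂) (.pair x y)) / (S one x * S one y)
        + S l y * S m x * dotS S P (.pair l₁ m₁) (.pair y x) *
          (starRingEnd ℂ) (dotS S P (.pair l₂ m₂) (.pair y x)) / (S one y * S one x) := by
    intro x y
    have hx := hne x
    have hy := hne y
    simp only [dotS, map_add, map_mul, hsymm x one, hsymm y one]
    field_simp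
    ring
  have hdiag : ∀ x, ∑ e : Fin 2,
        dotS S P (.pair l m) (.diag x e) * dotS S P (.pair l₁ m₁) (.diag x e) *
          (starRingEnd ℂ) (dotS S P (.pair l₂ m₂) (.diag x e)) / dotS S P (.diag one 0) (.diag x e)
      = S l x * S m x * dotS S P (.pair l₁ m₁) (.pair x x) *
          (starRingEnd ℂ) (dotS S P (.pair l₂ m₂) (.pair x x)) / (S one x * S one x) := by
    intro x
    have hx := hne x
    simp only [dotS, map_add, map_mul, Fin.sum_univ_two]
    field_simp
    ring
  have htw : ∀ x, ∑ e : Fin 2,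
      dotS S P (.pair l m) (.tw x e) * dotS S P (.pair l₁ m₁) (.tw x e) *
        (starRingEnd ℂ) (dotS S P (.pair l₂ m₂) (.tw x e)) / dotS S P (.diag one 0) (.tw x e)
      = 0 := by
    intro x
    simp [dotS]
  simp only [dotN, hpair, hdiag, htw, Finset.sum_const_zero, add_zero]
  rw [half_sum_symmetrized_offDiag_add_diag (fun x y =>
    S l x * S m y * dotS S P (.pair l₁ m₁) (.pair x y) *
      (starRingEnd ℂ) (dotS S P (.pair l₂ m₂) (.pair x y)) / (S one x * S one y))]
  simp only [fusN, Finset.sum_mul_sum, ← Finset.sum_add_distrib]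
  refine Finset.sum_congr rfl fun x _ => Finset.sum_congr rfl fun y _ => ?_
  simp only [dotS, map_add, map_mul]
  have hx := hne x
  have hy := hne y
  field_simp
  ring
end
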